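/- arXiv:1803.00528 — 2 statements merged into one kernel-verified Lean document; each statement's English description precedes it below -/
import Mathlib

section
/- Consider the zero-sum game with horizontal trajectories in the Heisenberg group under assumptions 1., 2., 3.. Let ψ ∈ Γ¹((0,T)×ℝ³), let (t₀,x₀) ∈ (0,T)×ℝ³, and suppose there exists θ > 0 such that ∂ψ/∂t(t₀,x₀) + H⁻(t₀, x₀, ∇_H ψ(t₀,x₀)) ≥ θ. Then for all sufficiently small τ > 0 there exists ỹ ∈ 𝒴(t₀) such that for every nonanticipative strategy β̃ ∈ 𝒮_β(t₀) one has ∫_{t₀}^{t₀+τ} ( ∂ψ/∂t(s, x̃(s)) + F(s, x̃(s), ỹ(s), β̃[ỹ](s)) − β̃[ỹ](s)·∇_H ψ(s, x̃(s)) ) ds ≥ τθ/2, where x̃ is the horizontal curve on [t₀, t₀+τ] with horizontal velocity β̃[ỹ] and initial point x₀. -/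
open MeasureTheory Set

noncomputable section

/-- Heisenberg group law on ℝ³. -/
def hMul (a b : ℝ × ℝ × ℝ) : ℝ × ℝ × ℝ :=
  (a.1 + b.1, a.2.1 + b.2.1, a.2.2 + b.2.2 + (a.1 * b.2.1 - b.1 * a.2.1) / 2)

/-- Korányi gauge. -/
def gaugeH (a : ℝ × ℝ × ℝ) : ℝ :=
  ((a.1 ^ 2 + a.2.1 ^ 2) ^ 2 + a.2.2 ^ 2) ^ ((1 : ℝ) / 4)

/-- Korányi distance `d_G(x,x') = ‖(x')⁻¹ ∘ x‖_G` (the inverse is `-x'`). -/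
def dG (a b : ℝ × ℝ × ℝ) : ℝ := gaugeH (hMul (-b) a)

/-- Euclidean norm on ℝ². -/
def norm2 (v : ℝ × ℝ) : ℝ := Real.sqrt (v.1 ^ 2 + v.2 ^ 2)

/-- Euclidean dot product on ℝ². -/
def dot2 (v w : ℝ × ℝ) : ℝ := v.1 * w.1 + v.2 * w.2

/-- Euclidean norm on ℝ³. -/
def norm3 (v : ℝ × ℝ × ℝ) : ℝ := Real.sqrt (v.1 ^ 2 + v.2.1 ^ 2 + v.2.2 ^ 2)

/-- The horizontal dynamics `f^ℍ(x,z) = (z₁, z₂, (z₂x₁ - z₁x₂)/2)`. -/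
def fH (x : ℝ × ℝ × ℝ) (z : ℝ × ℝ) : ℝ × ℝ × ℝ :=
  (z.1, z.2, (z.2 * x.1 - z.1 * x.2.1) / 2)

/-- `x` is the horizontal curve on `[a,b]` with horizontal velocity `z` and
initial point `ξ`, i.e. `x(t) = ξ + ∫_a^t f^ℍ(x(s), z(s)) ds`. -/
def IsHorizontalCurveOn (a b : ℝ) (z : ℝ → ℝ × ℝ) (ξ : ℝ × ℝ × ℝ)
    (x : ℝ → ℝ × ℝ × ℝ) : Prop :=
  ∀ t ∈ Set.Icc a b, x t = ξ + ∫ s in a..t, fH (x s) (z s)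

/-- The set of controls at time `τ` with values in the closed ball of radius `R`:
measurable functions `[τ,T] → {v : ‖v‖ ≤ R}` (extended to all of ℝ). -/
abbrev Control (τ T R : ℝ) : Type :=
  {y : ℝ → ℝ × ℝ // Measurable y ∧ ∀ t ∈ Set.Icc τ T, norm2 (y t) ≤ R}

/-- Nonanticipative strategies for Player II at time `τ`: maps `β : 𝒴(τ) → 𝒵(τ)`
such that `y = y'` a.e. on `[τ,t]` implies `β[y] = β[y']` a.e. on `[τ,t]`. -/
structure Strategy (τ T RY RZ : ℝ) where
  toFun : Control τ T RY → Control τ T RZ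
  nonanticipative : ∀ t ∈ Set.Icc τ T, ∀ y y' : Control τ T RY,
    (∀ᵐ s ∂(volume.restrict (Set.Icc τ t)), y.1 s = y'.1 s) →
    (∀ᵐ s ∂(volume.restrict (Set.Icc τ t)), (toFun y).1 s = (toFun y').1 s)

/-- Nonanticipative strategies for Player I at time `τ`: maps `α : 𝒵(τ) → 𝒴(τ)`. -/
structure StrategyI (τ T RY RZ : ℝ) where
  toFun : Control τ T RZ → Control τ T RY
  nonanticipative : ∀ t ∈ Set.Icc τ T, ∀ z z' : Control τ T RZ,
    (∀ᵐ s ∂(volume.restrict (Set.Icc τ t)), z.1 s = z'.1 s) →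
    (∀ᵐ s ∂(volume.restrict (Set.Icc τ t)), (toFun z).1 s = (toFun z').1 s)

/-- The horizontal curve on `[a, ·]` with horizontal velocity `z` and initial point `ξ`,
given explicitly: `x₁, x₂` are integrals of `z₁, z₂`, and
`x₃(t) = ξ₃ + ∫ (z₂ x₁ - z₁ x₂)/2`.  It is the unique solution of
`x(t) = ξ + ∫_a^t f^ℍ(x(s), z(s)) ds`. -/
def horiz (a : ℝ) (ξ : ℝ × ℝ × ℝ) (z : ℝ → ℝ × ℝ) (t : ℝ) : ℝ × ℝ × ℝ :=
  (ξ.1 + ∫ s in a..t, (z s).1,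
   ξ.2.1 + ∫ s in a..t, (z s).2,
   ξ.2.2 + ∫ s in a..t,
     ((z s).2 * (ξ.1 + ∫ r in a..s, (z r).1) -
      (z s).1 * (ξ.2.1 + ∫ r in a..s, (z r).2)) / 2)

/-- The lower value function
`V⁻(τ,ξ) = inf_β sup_y { ∫_τ^T F(t, x(t), y(t), β[y](t)) dt + g(x(T)) }`,
where `x` is the horizontal curve on `[τ,T]` with horizontal velocity `-β[y]`
and initial point `ξ`. -/
def lowerValue (T RY RZ : ℝ) (F : ℝ → (ℝ × ℝ × ℝ) → (ℝ × ℝ) → (ℝ × ℝ) → ℝ)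
    (g : (ℝ × ℝ × ℝ) → ℝ) (τ : ℝ) (ξ : ℝ × ℝ × ℝ) : ℝ :=
  ⨅ β : Strategy τ T RY RZ, ⨆ y : Control τ T RY,
    ((∫ t in τ..T,
        F t (horiz τ ξ (fun s => -((β.toFun y).1 s)) t) (y.1 t) ((β.toFun y).1 t)) +
      g (horiz τ ξ (fun s => -((β.toFun y).1 s)) T))

/-- The upper value function
`V⁺(τ,ξ) = sup_α inf_z { ∫_τ^T F(t, x(t), α[z](t), z(t)) dt + g(x(T)) }`,
where `x` is the horizontal curve on `[τ,T]` with horizontal velocity `-z`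
and initial point `ξ`. -/
def upperValue (T RY RZ : ℝ) (F : ℝ → (ℝ × ℝ × ℝ) → (ℝ × ℝ) → (ℝ × ℝ) → ℝ)
    (g : (ℝ × ℝ × ℝ) → ℝ) (τ : ℝ) (ξ : ℝ × ℝ × ℝ) : ℝ :=
  ⨆ α : StrategyI τ T RY RZ, ⨅ z : Control τ T RZ,
    ((∫ t in τ..T,
        F t (horiz τ ξ (fun s => -(z.1 s)) t) ((α.toFun z).1 t) (z.1 t)) +
      g (horiz τ ξ (fun s => -(z.1 s)) T))

/-- The horizontal derivative `X₁u(x) = ∂_{x₁}u - (x₂/2)∂_{x₃}u`, as a line derivative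
along the horizontal direction `(1, 0, -x₂/2)`. -/
def X1d (u : ℝ × ℝ × ℝ → ℝ) (x : ℝ × ℝ × ℝ) : ℝ :=
  deriv (fun s : ℝ => u (x.1 + s, x.2.1, x.2.2 - s * x.2.1 / 2)) 0

/-- The horizontal derivative `X₂u(x) = ∂_{x₂}u + (x₁/2)∂_{x₃}u`. -/
def X2d (u : ℝ × ℝ × ℝ → ℝ) (x : ℝ × ℝ × ℝ) : ℝ :=
  deriv (fun s : ℝ => u (x.1, x.2.1 + s, x.2.2 + s * x.1 / 2)) 0

/-- The horizontal gradient `∇_H u(t,x) = (X₁u(t,·)(x), X₂u(t,·)(x)) ∈ ℝ²` of a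
function of `(t,x)`. -/
def gradH (u : ℝ → (ℝ × ℝ × ℝ) → ℝ) (t : ℝ) (x : ℝ × ℝ × ℝ) : ℝ × ℝ :=
  (X1d (u t) x, X2d (u t) x)

/-- The time derivative `∂u/∂t (t,x)`. -/
def partialT (u : ℝ → (ℝ × ℝ × ℝ) → ℝ) (t : ℝ) (x : ℝ × ℝ × ℝ) : ℝ :=
  deriv (fun s : ℝ => u s x) t

/-- `u ∈ Γ¹((0,T)×ℍ)`: the derivatives `∂u/∂t`, `X₁u`, `X₂u` exist and
`(t,x) ↦ (∂u/∂t, X₁u, X₂u)(t,x)` is continuous on `(0,T)×ℍ`. -/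
def Gamma1On (T : ℝ) (u : ℝ → (ℝ × ℝ × ℝ) → ℝ) : Prop :=
  (∀ t ∈ Set.Ioo 0 T, ∀ x : ℝ × ℝ × ℝ,
      DifferentiableAt ℝ (fun s : ℝ => u s x) t ∧
      DifferentiableAt ℝ (fun s : ℝ => u t (x.1 + s, x.2.1, x.2.2 - s * x.2.1 / 2)) 0 ∧
      DifferentiableAt ℝ (fun s : ℝ => u t (x.1, x.2.1 + s, x.2.2 + s * x.1 / 2)) 0) ∧
  ContinuousOn (fun p : ℝ × (ℝ × ℝ × ℝ) => (partialT u p.1 p.2, gradH u p.1 p.2))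
    (Set.Ioo 0 T ×ˢ (Set.univ : Set (ℝ × ℝ × ℝ)))

/-- The lower Hamiltonian `H⁻(t,x,λ) = max_{y∈Y} min_{z∈Z} (F(t,x,y,z) - λ·z)`. -/
def lowerHam (RY RZ : ℝ) (F : ℝ → (ℝ × ℝ × ℝ) → (ℝ × ℝ) → (ℝ × ℝ) → ℝ)
    (t : ℝ) (x : ℝ × ℝ × ℝ) (lam : ℝ × ℝ) : ℝ :=
  ⨆ y : {y : ℝ × ℝ // norm2 y ≤ RY}, ⨅ z : {z : ℝ × ℝ // norm2 z ≤ RZ},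
    (F t x y.1 z.1 - dot2 lam z.1)

/-- The upper Hamiltonian `H⁺(t,x,λ) = min_{z∈Z} max_{y∈Y} (F(t,x,y,z) - λ·z)`. -/
def upperHam (RY RZ : ℝ) (F : ℝ → (ℝ × ℝ × ℝ) → (ℝ × ℝ) → (ℝ × ℝ) → ℝ)
    (t : ℝ) (x : ℝ × ℝ × ℝ) (lam : ℝ × ℝ) : ℝ :=
  ⨅ z : {z : ℝ × ℝ // norm2 z ≤ RZ}, ⨆ y : {y : ℝ × ℝ // norm2 y ≤ RY},
    (F t x y.1 z.1 - dot2 lam z.1)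

/-- `u` is a viscosity solution of `∂u/∂t + 𝓗(t,x,∇_H u) = 0` on `(0,T)×ℍ` with
terminal condition `u(T,x) = g(x)`: `u` is bounded and uniformly continuous,
`u(T,·) = g`, and the sub/supersolution inequalities hold for `Γ¹` test functions
touching `u` from above/below. -/
def IsViscositySolutionTerminal (T : ℝ) (H : ℝ → (ℝ × ℝ × ℝ) → (ℝ × ℝ) → ℝ)
    (g : (ℝ × ℝ × ℝ) → ℝ) (u : ℝ → (ℝ × ℝ × ℝ) → ℝ) : Prop :=
  (∃ M : ℝ, ∀ t ∈ Set.Icc 0 T, ∀ x : ℝ × ℝ × ℝ, |u t x| ≤ M) ∧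
  UniformContinuousOn (fun p : ℝ × (ℝ × ℝ × ℝ) => u p.1 p.2)
    (Set.Icc 0 T ×ˢ (Set.univ : Set (ℝ × ℝ × ℝ))) ∧
  (∀ x : ℝ × ℝ × ℝ, u T x = g x) ∧
  (∀ t0 ∈ Set.Ioo 0 T, ∀ x0 : ℝ × ℝ × ℝ, ∀ ψ : ℝ → (ℝ × ℝ × ℝ) → ℝ,
    Gamma1On T ψ → u t0 x0 = ψ t0 x0 →
    (∀ᶠ p : ℝ × (ℝ × ℝ × ℝ) in nhds (t0, x0), u p.1 p.2 ≤ ψ p.1 p.2) →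
    0 ≤ partialT ψ t0 x0 + H t0 x0 (gradH ψ t0 x0)) ∧
  (∀ t0 ∈ Set.Ioo 0 T, ∀ x0 : ℝ × ℝ × ℝ, ∀ ψ : ℝ → (ℝ × ℝ × ℝ) → ℝ,
    Gamma1On T ψ → u t0 x0 = ψ t0 x0 →
    (∀ᶠ p : ℝ × (ℝ × ℝ × ℝ) in nhds (t0, x0), ψ p.1 p.2 ≤ u p.1 p.2) →
    partialT ψ t0 x0 + H t0 x0 (gradH ψ t0 x0) ≤ 0)

/-- `u` is a viscosity solution of `∂u/∂t + 𝓗(t,x,∇_H u) = 0` on `(0,T)×ℍ` with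
initial condition `u(0,x) = g(x)` (the inequalities are reversed w.r.t. the terminal
value problem). -/
def IsViscositySolutionInitial (T : ℝ) (H : ℝ → (ℝ × ℝ × ℝ) → (ℝ × ℝ) → ℝ)
    (g : (ℝ × ℝ × ℝ) → ℝ) (u : ℝ → (ℝ × ℝ × ℝ) → ℝ) : Prop :=
  (∃ M : ℝ, ∀ t ∈ Set.Icc 0 T, ∀ x : ℝ × ℝ × ℝ, |u t x| ≤ M) ∧
  UniformContinuousOn (fun p : ℝ × (ℝ × ℝ × ℝ) => u p.1 p.2)
    (Set.Icc 0 T ×ˢ (Set.univ : Set (ℝ × ℝ × ℝ))) ∧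
  (∀ x : ℝ × ℝ × ℝ, u 0 x = g x) ∧
  (∀ t0 ∈ Set.Ioo 0 T, ∀ x0 : ℝ × ℝ × ℝ, ∀ ψ : ℝ → (ℝ × ℝ × ℝ) → ℝ,
    Gamma1On T ψ → u t0 x0 = ψ t0 x0 →
    (∀ᶠ p : ℝ × (ℝ × ℝ × ℝ) in nhds (t0, x0), u p.1 p.2 ≤ ψ p.1 p.2) →
    partialT ψ t0 x0 + H t0 x0 (gradH ψ t0 x0) ≤ 0) ∧
  (∀ t0 ∈ Set.Ioo 0 T, ∀ x0 : ℝ × ℝ × ℝ, ∀ ψ : ℝ → (ℝ × ℝ × ℝ) → ℝ,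
    Gamma1On T ψ → u t0 x0 = ψ t0 x0 →
    (∀ᶠ p : ℝ × (ℝ × ℝ × ℝ) in nhds (t0, x0), ψ p.1 p.2 ≤ u p.1 p.2) →
    0 ≤ partialT ψ t0 x0 + H t0 x0 (gradH ψ t0 x0))

/-- The coordinates of a planar vector are bounded by its Euclidean norm. -/
lemma abs_coords_le_of_norm2_le {v : ℝ × ℝ} {R : ℝ} (h : norm2 v ≤ R) :
    |v.1| ≤ R ∧ |v.2| ≤ R := by
  constructor
  · exact (Real.abs_le_sqrt (by nlinarith [sq_nonneg v.2])).trans h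
  · exact (Real.abs_le_sqrt (by nlinarith [sq_nonneg v.1])).trans h

lemma abs_dot2_le {v w : ℝ × ℝ} {A R : ℝ} (hv : |v.1| ≤ A ∧ |v.2| ≤ A)
    (hw : |w.1| ≤ R ∧ |w.2| ≤ R) : |dot2 v w| ≤ 2 * (A * R) := by
  have hA : 0 ≤ A := (abs_nonneg _).trans hv.1
  have h1 : |v.1 * w.1| ≤ A * R := by
    rw [abs_mul]; exact mul_le_mul hv.1 hw.1 (abs_nonneg _) hA
  have h2 : |v.2 * w.2| ≤ A * R := by
    rw [abs_mul]; exact mul_le_mul hv.2 hw.2 (abs_nonneg _) hA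
  have := abs_add_le (v.1 * w.1) (v.2 * w.2)
  unfold dot2
  linarith

lemma continuous_norm2 : Continuous norm2 := by
  unfold norm2; fun_prop

lemma abs_primitive_le {f : ℝ → ℝ} {a t C : ℝ} (hat : a ≤ t)
    (h : ∀ s ∈ Icc a t, |f s| ≤ C) : |∫ s in a..t, f s| ≤ C * (t - a) := by
  have := intervalIntegral.norm_integral_le_of_norm_le_const (a := a) (b := t) (f := f) (C := C)
    (fun s hs => by
      rw [uIoc_of_le hat] at hs
      exact h s ⟨hs.1.le, hs.2⟩)
  rwa [Real.norm_eq_abs, abs_of_nonneg (sub_nonneg.2 hat)] at this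

/-- A function continuous on a measurable set is a.e. measurable along a measurable path
that stays in the set. -/
lemma aemeasurable_comp_of_continuousOn {α E : Type*} [MeasurableSpace α] [TopologicalSpace E]
    [MeasurableSpace E] [BorelSpace E] {μ : Measure α} {G : E → ℝ} {S : Set E} {g : α → E}
    (hG : ContinuousOn G S) (hS : MeasurableSet S) (hg : AEMeasurable g μ)
    (hgS : ∀ᵐ s ∂μ, g s ∈ S) : AEMeasurable (fun s => G (g s)) μ := by
  have h : AEMeasurable G ((μ.map g).restrict S) := hG.aemeasurable hS
  rw [Measure.restrict_eq_self_of_ae_mem ((ae_map_iff hg hS).2 hgS)] at h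
  exact h.comp_aemeasurable hg

/-- The horizontal curve with bounded measurable velocity is Lipschitz at its initial point. -/
lemma dist_horiz_le {a b R : ℝ} (ξ : ℝ × ℝ × ℝ) {z : ℝ → ℝ × ℝ}
    (hz : ∀ t ∈ Icc a b, norm2 (z t) ≤ R) {t : ℝ} (ht : t ∈ Icc a b) :
    dist (horiz a ξ z t) ξ ≤
      (R + R * (|ξ.1| + |ξ.2.1| + 2 * (R * (b - a)))) * (t - a) := by
  have hab : a ≤ b := ht.1.trans ht.2
  have hR : 0 ≤ R := (Real.sqrt_nonneg _).trans (hz a ⟨le_rfl, hab⟩)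
  have hc := fun s hs => abs_coords_le_of_norm2_le (hz s hs)
  have hsub : ∀ s ∈ Icc a b, ∀ r ∈ Icc a s, r ∈ Icc a b := fun s hs r hr =>
    ⟨hr.1, hr.2.trans hs.2⟩
  have h1 : ∀ s ∈ Icc a b, |∫ r in a..s, (z r).1| ≤ R * (s - a) := fun s hs =>
    abs_primitive_le hs.1 fun r hr => (hc r (hsub s hs r hr)).1
  have h2 : ∀ s ∈ Icc a b, |∫ r in a..s, (z r).2| ≤ R * (s - a) := fun s hs =>
    abs_primitive_le hs.1 fun r hr => (hc r (hsub s hs r hr)).2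
  have h3 : |∫ s in a..t, ((z s).2 * (ξ.1 + ∫ r in a..s, (z r).1) -
      (z s).1 * (ξ.2.1 + ∫ r in a..s, (z r).2)) / 2| ≤
      R * (|ξ.1| + |ξ.2.1| + 2 * (R * (b - a))) * (t - a) := by
    refine abs_primitive_le ht.1 fun s hs => ?_
    have hs' := hsub t ht s hs
    have hle : R * (s - a) ≤ R * (b - a) := by
      have := hs'.2
      gcongr
    have e1 : |(z s).2 * (ξ.1 + ∫ r in a..s, (z r).1)| ≤ R * (|ξ.1| + R * (b - a)) := by
      rw [abs_mul]
      refine mul_le_mul (hc s hs').2 ?_ (abs_nonneg _) hR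
      exact (abs_add_le _ _).trans (by linarith [h1 s hs'])
    have e2 : |(z s).1 * (ξ.2.1 + ∫ r in a..s, (z r).2)| ≤ R * (|ξ.2.1| + R * (b - a)) := by
      rw [abs_mul]
      refine mul_le_mul (hc s hs').1 ?_ (abs_nonneg _) hR
      exact (abs_add_le _ _).trans (by linarith [h2 s hs'])
    rw [abs_le] at e1 e2 ⊢
    constructor <;> linarith
  have hM : 0 ≤ R * (|ξ.1| + |ξ.2.1| + 2 * (R * (b - a))) := by
    have : 0 ≤ b - a := sub_nonneg.2 hab
    positivity
  have hta : 0 ≤ t - a := sub_nonneg.2 ht.1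
  have hp := mul_nonneg hM hta
  have hq := mul_nonneg hR hta
  rw [add_mul]
  simp only [horiz, Prod.dist_eq, Real.dist_eq, add_sub_cancel_left]
  refine max_le ?_ (max_le ?_ ?_)
  · linarith [h1 t ht]
  · linarith [h2 t ht]
  · linarith

lemma integrableOn_of_abs_le {f : ℝ → ℝ} {a b C : ℝ}
    (hf : AEMeasurable f (volume.restrict (Icc a b))) (h : ∀ s ∈ Icc a b, |f s| ≤ C) :
    IntegrableOn f (Icc a b) :=
  have : IsFiniteMeasure (volume.restrict (Icc a b)) := ⟨by simp⟩
  Integrable.of_bound hf.aestronglyMeasurable C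
    ((ae_restrict_iff' measurableSet_Icc).2 (Filter.Eventually.of_forall h))

lemma continuousOn_horiz {a b R : ℝ} (hab : a ≤ b) (ξ : ℝ × ℝ × ℝ) {z : ℝ → ℝ × ℝ}
    (hzm : Measurable z) (hz : ∀ t ∈ Icc a b, norm2 (z t) ≤ R) :
    ContinuousOn (horiz a ξ z) (Icc a b) := by
  have hc := fun s hs => abs_coords_le_of_norm2_le (hz s hs)
  have i1 : IntegrableOn (fun s => (z s).1) (Icc a b) :=
    integrableOn_of_abs_le hzm.fst.aemeasurable fun s hs => (hc s hs).1
  have i2 : IntegrableOn (fun s => (z s).2) (Icc a b) :=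
    integrableOn_of_abs_le hzm.snd.aemeasurable fun s hs => (hc s hs).2
  have prim : ∀ f : ℝ → ℝ, IntegrableOn f (Icc a b) →
      ContinuousOn (fun t => ∫ s in a..t, f s) (Icc a b) := fun f hf => by
    rw [← uIcc_of_le hab] at hf ⊢
    exact intervalIntegral.continuousOn_primitive_interval hf
  have c1 : ContinuousOn (fun t => ξ.1 + ∫ s in a..t, (z s).1) (Icc a b) :=
    continuousOn_const.add (prim _ i1)
  have c2 : ContinuousOn (fun t => ξ.2.1 + ∫ s in a..t, (z s).2) (Icc a b) :=
    continuousOn_const.add (prim _ i2)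
  have i3 : IntegrableOn (fun s => ((z s).2 * (ξ.1 + ∫ r in a..s, (z r).1) -
      (z s).1 * (ξ.2.1 + ∫ r in a..s, (z r).2)) / 2) (Icc a b) :=
    ((i2.mul_continuousOn c1 isCompact_Icc).sub
      (i1.mul_continuousOn c2 isCompact_Icc)).div_const 2
  exact c1.prodMk (c2.prodMk (continuousOn_const.add (prim _ i3)))

/-- A lower bound on the lower Hamiltonian is attained up to any loss by a single action of
the first player against all actions of the second. -/
lemma exists_forall_lt_of_lt_lowerHam {RY RZ C c t : ℝ} (hRY : 0 ≤ RY)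
    {F : ℝ → (ℝ × ℝ × ℝ) → (ℝ × ℝ) → (ℝ × ℝ) → ℝ} {x : ℝ × ℝ × ℝ} {lam : ℝ × ℝ}
    (hF : ∀ y z : ℝ × ℝ, norm2 y ≤ RY → norm2 z ≤ RZ → |F t x y z| ≤ C)
    (h : c < lowerHam RY RZ F t x lam) :
    ∃ y : ℝ × ℝ, norm2 y ≤ RY ∧ ∀ z : ℝ × ℝ, norm2 z ≤ RZ → c < F t x y z - dot2 lam z := by
  have : Nonempty {y : ℝ × ℝ // norm2 y ≤ RY} := ⟨⟨0, by simpa [norm2] using hRY⟩⟩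
  obtain ⟨y, hy⟩ := exists_lt_of_lt_ciSup h
  refine ⟨y.1, y.2, fun z hz => hy.trans_le ?_⟩
  refine ciInf_le (f := fun z : {z : ℝ × ℝ // norm2 z ≤ RZ} => F t x y.1 z.1 - dot2 lam z.1)
    ?_ ⟨z, hz⟩
  refine ⟨-C - 2 * (max |lam.1| |lam.2| * RZ), ?_⟩
  rintro _ ⟨w, rfl⟩
  have h1 := abs_le.1 (hF y.1 w.1 y.2 w.2)
  have h2 := abs_le.1 (abs_dot2_le (v := lam) ⟨le_max_left _ _, le_max_right _ _⟩
    (abs_coords_le_of_norm2_le w.2))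
  dsimp only
  linarith [h1.1, h2.2]

/-- if `∂ψ/∂t(t₀,x₀) + H⁻(t₀,x₀,∇_Hψ(t₀,x₀)) ≥ θ > 0`, then for all
sufficiently small `τ > 0` there is a control `ỹ ∈ 𝒴(t₀)` such that for every
nonanticipative strategy `β̃` the integral inequality `... ≥ τθ/2` holds along the
horizontal curve with velocity `β̃[ỹ]` starting at `x₀`. -/
theorem stmt_11 (T RY RZ C1 C1' : ℝ) (hT : 0 < T) (hRY : 0 < RY) (hRZ : 0 < RZ)
    (F : ℝ → (ℝ × ℝ × ℝ) → (ℝ × ℝ) → (ℝ × ℝ) → ℝ)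
    (hFuc : UniformContinuousOn
      (fun p : ℝ × (ℝ × ℝ × ℝ) × (ℝ × ℝ) × (ℝ × ℝ) => F p.1 p.2.1 p.2.2.1 p.2.2.2)
      (Set.Icc 0 T ×ˢ (Set.univ : Set (ℝ × ℝ × ℝ)) ×ˢ
        {y : ℝ × ℝ | norm2 y ≤ RY} ×ˢ {z : ℝ × ℝ | norm2 z ≤ RZ}))
    (hFb : ∀ t ∈ Set.Icc 0 T, ∀ (x : ℝ × ℝ × ℝ) (y z : ℝ × ℝ),
      norm2 y ≤ RY → norm2 z ≤ RZ → |F t x y z| ≤ C1)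
    (hFl : ∀ t ∈ Set.Icc 0 T, ∀ (x x' : ℝ × ℝ × ℝ) (y z : ℝ × ℝ),
      norm2 y ≤ RY → norm2 z ≤ RZ → |F t x y z - F t x' y z| ≤ C1' * dG x x')
    (ψ : ℝ → (ℝ × ℝ × ℝ) → ℝ) (hψ : Gamma1On T ψ)
    (t0 : ℝ) (ht0 : t0 ∈ Set.Ioo 0 T) (x0 : ℝ × ℝ × ℝ)
    (θ : ℝ) (hθ : 0 < θ)
    (hineq : θ ≤ partialT ψ t0 x0 + lowerHam RY RZ F t0 x0 (gradH ψ t0 x0)) :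
    ∃ τ0 > 0, ∀ τ : ℝ, 0 < τ → τ ≤ τ0 →
      ∃ ytil : Control t0 T RY, ∀ βtil : Strategy t0 T RY RZ,
        τ * θ / 2 ≤
          ∫ s in t0..(t0 + τ),
            (partialT ψ s (horiz t0 x0 ((βtil.toFun ytil).1) s) +
              F s (horiz t0 x0 ((βtil.toFun ytil).1) s) (ytil.1 s)
                ((βtil.toFun ytil).1 s) -
              dot2 ((βtil.toFun ytil).1 s)
                (gradH ψ s (horiz t0 x0 ((βtil.toFun ytil).1) s))) := by
  obtain ⟨y, hy, hyz⟩ := exists_forall_lt_of_lt_lowerHam (c := 3 * θ / 4 - partialT ψ t0 x0)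
    hRY.le (hFb t0 ⟨ht0.1.le, ht0.2.le⟩ x0) (lt_of_lt_of_le (by linarith)
      (sub_le_iff_le_add'.2 hineq))
  set D : Set (ℝ × (ℝ × ℝ × ℝ)) := Ioo 0 T ×ˢ univ with hD
  have hDopen : IsOpen D := isOpen_Ioo.prod isOpen_univ
  have hx0D : (t0, x0) ∈ D := ⟨ht0, mem_univ _⟩
  have hψc := hψ.2
  set ε := θ / (32 * (1 + RZ)) with hε
  have hεpos : 0 < ε := by positivity
  have hεθ : ε * (1 + RZ) = θ / 32 := by rw [hε]; field_simp
  obtain ⟨δ₁, hδ₁, hF₁⟩ := Metric.uniformContinuousOn_iff.1 hFuc (θ / 16) (by positivity)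
  obtain ⟨δ₂, hδ₂, hψ₁⟩ := Metric.continuousAt_iff.1
    (hψc.continuousAt (hDopen.mem_nhds hx0D)) ε hεpos
  set K := RZ + RZ * (|x0.1| + |x0.2.1| + 2 * (RZ * (T - t0))) with hK
  have hT0 : 0 < T - t0 := sub_pos.2 ht0.2
  have hKpos : 0 < K := by positivity
  set δ := min δ₁ δ₂ with hδ
  have hδpos : 0 < δ := lt_min hδ₁ hδ₂
  refine ⟨min ((T - t0) / 2) (δ / (2 * (1 + K))), by positivity, fun τ hτ hτ0 => ?_⟩
  have hτT : t0 + τ < T := by linarith [hτ0.trans (min_le_left _ _)]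
  have hτK : (1 + K) * τ < δ := by
    have := (le_div_iff₀ (by positivity)).1 (hτ0.trans (min_le_right _ _))
    linarith
  refine ⟨⟨fun _ => y, measurable_const, fun _ _ => hy⟩, fun β => ?_⟩
  generalize β.toFun ⟨fun _ => y, measurable_const, fun _ _ => hy⟩ = ζ
  obtain ⟨z, hzm, hz⟩ := ζ
  dsimp only
  have hI : ∀ s ∈ Icc t0 (t0 + τ), s ∈ Icc t0 T ∧ s ∈ Ioo 0 T := fun s hs =>
    ⟨⟨hs.1, hs.2.trans hτT.le⟩, ht0.1.trans_le hs.1, hs.2.trans_lt hτT⟩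
  have hnear : ∀ s ∈ Icc t0 (t0 + τ), dist (s, horiz t0 x0 z s) (t0, x0) < δ := fun s hs => by
    have hsτ : s - t0 ≤ τ := by linarith [hs.2]
    have hs0 : 0 ≤ s - t0 := sub_nonneg.2 hs.1
    have h := dist_horiz_le x0 hz (hI s hs).1
    rw [← hK] at h
    have h' : K * (s - t0) ≤ K * τ := by gcongr
    rw [Prod.dist_eq]
    refine max_lt ?_ ?_
    · simp only [Real.dist_eq, abs_of_nonneg hs0]
      nlinarith
    · exact h.trans_lt (by linarith)
  have hx : AEMeasurable (horiz t0 x0 z) (volume.restrict (Icc t0 (t0 + τ))) :=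
    ((continuousOn_horiz ht0.2.le x0 hzm hz).mono fun s hs => (hI s hs).1).aemeasurable
      measurableSet_Icc
  have hest : ∀ s ∈ Icc t0 (t0 + τ),
      |partialT ψ s (horiz t0 x0 z s) - partialT ψ t0 x0| < θ / 32 ∧
      |F s (horiz t0 x0 z s) y (z s) - F t0 x0 y (z s)| < θ / 16 ∧
      |dot2 (z s) (gradH ψ s (horiz t0 x0 z s)) - dot2 (gradH ψ t0 x0) (z s)| ≤ θ / 16 := by
    intro s hs
    have hn := hnear s hs
    have hzs := hz s (hI s hs).1
    have h1 := hψ₁ (hn.trans_le (min_le_right _ _))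
    simp only [Prod.dist_eq, max_lt_iff, Real.dist_eq] at h1
    obtain ⟨h1, h2, h3⟩ := h1
    refine ⟨h1.trans_le (by nlinarith), ?_, ?_⟩
    · have := hF₁ (s, horiz t0 x0 z s, y, z s) ⟨⟨(hI s hs).2.1.le, (hI s hs).2.2.le⟩,
        mem_univ _, hy, hzs⟩ (t0, x0, y, z s) ⟨⟨ht0.1.le, ht0.2.le⟩, mem_univ _, hy, hzs⟩ (by
          have hd := hn.trans_le (min_le_left _ _)
          rw [Prod.dist_eq, max_lt_iff] at hd
          simp only [Prod.dist_eq (α := ℝ) (β := (ℝ × ℝ × ℝ) × (ℝ × ℝ) × (ℝ × ℝ)),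
            Prod.dist_eq (α := ℝ × ℝ × ℝ) (β := (ℝ × ℝ) × (ℝ × ℝ)), dist_self]
          exact max_lt hd.1 (max_lt hd.2 hδ₁))
      simpa only [Real.dist_eq] using this
    · have := abs_dot2_le (v := gradH ψ s (horiz t0 x0 z s) - gradH ψ t0 x0) (w := z s)
        ⟨h2.le, h3.le⟩ (abs_coords_le_of_norm2_le hzs)
      have e : dot2 (z s) (gradH ψ s (horiz t0 x0 z s)) - dot2 (gradH ψ t0 x0) (z s) =
          dot2 (gradH ψ s (horiz t0 x0 z s) - gradH ψ t0 x0) (z s) := by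
        simp only [dot2, Prod.fst_sub, Prod.snd_sub]; ring
      rw [e]
      exact this.trans (by linarith)
  have hpath : AEMeasurable (fun s => (s, horiz t0 x0 z s))
      (volume.restrict (Icc t0 (t0 + τ))) := aemeasurable_id.prodMk hx
  have hpathD : ∀ᵐ s ∂volume.restrict (Icc t0 (t0 + τ)), (s, horiz t0 x0 z s) ∈ D :=
    (ae_restrict_iff' measurableSet_Icc).2
      (Filter.Eventually.of_forall fun s hs => ⟨(hI s hs).2, mem_univ _⟩)
  have m1 : AEMeasurable (fun s => partialT ψ s (horiz t0 x0 z s))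
      (volume.restrict (Icc t0 (t0 + τ))) :=
    aemeasurable_comp_of_continuousOn hψc.fst hDopen.measurableSet hpath hpathD
  have m2 : AEMeasurable (fun s => (gradH ψ s (horiz t0 x0 z s)).1)
      (volume.restrict (Icc t0 (t0 + τ))) :=
    aemeasurable_comp_of_continuousOn (G := fun p => (gradH ψ p.1 p.2).1)
      hψc.snd.fst hDopen.measurableSet hpath hpathD
  have m3 : AEMeasurable (fun s => (gradH ψ s (horiz t0 x0 z s)).2)
      (volume.restrict (Icc t0 (t0 + τ))) :=
    aemeasurable_comp_of_continuousOn (G := fun p => (gradH ψ p.1 p.2).2)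
      hψc.snd.snd hDopen.measurableSet hpath hpathD
  have m4 : AEMeasurable (fun s => F s (horiz t0 x0 z s) y (z s))
      (volume.restrict (Icc t0 (t0 + τ))) := by
    refine aemeasurable_comp_of_continuousOn (g := fun s => (s, horiz t0 x0 z s, y, z s))
      hFuc.continuousOn ?_ (aemeasurable_id.prodMk (hx.prodMk
        (aemeasurable_const.prodMk hzm.aemeasurable))) ?_
    · exact (isClosed_Icc.prod (isClosed_univ.prod
        ((isClosed_le continuous_norm2 continuous_const).prod
          (isClosed_le continuous_norm2 continuous_const)))).measurableSet
    · exact (ae_restrict_iff' measurableSet_Icc).2 (Filter.Eventually.of_forall fun s hs =>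
        ⟨⟨(hI s hs).2.1.le, (hI s hs).2.2.le⟩, mem_univ _, hy, hz s (hI s hs).1⟩)
  have hint : IntegrableOn (fun s => partialT ψ s (horiz t0 x0 z s) +
      F s (horiz t0 x0 z s) y (z s) - dot2 (z s) (gradH ψ s (horiz t0 x0 z s)))
      (Icc t0 (t0 + τ)) := by
    refine integrableOn_of_abs_le (C := |partialT ψ t0 x0| + C1 +
      2 * (max |(gradH ψ t0 x0).1| |(gradH ψ t0 x0).2| * RZ) + θ) ?_ fun s hs => ?_
    · exact (m1.add m4).sub
        ((hzm.fst.aemeasurable.mul m2).add (hzm.snd.aemeasurable.mul m3))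
    · obtain ⟨h1, h2, h3⟩ := hest s hs
      have hzs := hz s (hI s hs).1
      have h4 := hFb t0 ⟨ht0.1.le, ht0.2.le⟩ x0 y (z s) hy hzs
      have h5 := abs_dot2_le (v := gradH ψ t0 x0) ⟨le_max_left _ _, le_max_right _ _⟩
        (abs_coords_le_of_norm2_le hzs)
      have h6 := neg_abs_le (partialT ψ t0 x0)
      have h7 := le_abs_self (partialT ψ t0 x0)
      rw [abs_lt] at h1 h2
      rw [abs_le] at h3 h4 h5 ⊢
      constructor <;> linarith [h1.1, h1.2, h2.1, h2.2, h3.1, h3.2, h4.1, h4.2, h5.1, h5.2]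
  have hle : t0 ≤ t0 + τ := by linarith
  calc τ * θ / 2 = ∫ _ in t0..(t0 + τ), θ / 2 := by
        rw [intervalIntegral.integral_const, smul_eq_mul]; ring
    _ ≤ _ := by
        refine intervalIntegral.integral_mono_on hle intervalIntegrable_const
          ((intervalIntegrable_iff_integrableOn_Icc_of_le hle).2 hint) fun s hs => ?_
        obtain ⟨h1, h2, h3⟩ := hest s hs
        have h4 := hyz (z s) (hz s (hI s hs).1)
        rw [abs_lt] at h1 h2
        rw [abs_le] at h3
        linarith [h1.1, h2.1, h3.2]
end
end

section
/- Let 𝓗 : [0,T]×ℝ³×ℝ² → ℝ satisfy |𝓗(t,x,y) − 𝓗(t,x,y')| ≤ K‖y − y'‖ for all t ∈ [0,T], x ∈ ℝ³, y, y' ∈ ℝ², with K > 0. Let Y = {y ∈ ℝ² : ‖y‖ ≤ R_Y} for some R_Y > 0, let Z = {z ∈ ℝ² : ‖z‖ ≤ K}, and define F(t,x,y,z) = −𝓗(T−t,x,y) + z·y and H⁻(s,x,λ) = max_{y∈Y} min_{z∈Z} ( F(s,x,y,z) − λ·z ). Then for every t ∈ [0,T], x ∈ ℝ³ and λ ∈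 Y one has 𝓗(t,x,λ) = min_{y∈Y} max_{z∈Z} ( 𝓗(t,x,y) + z·(λ−y) ) = min_{y∈Y} ( 𝓗(t,x,y) + K‖λ−y‖ ), and consequently H⁻(T−t, x, λ) = −𝓗(t,x,λ). -/
open MeasureTheory Set

noncomputable section

theorem norm2_nonneg (v : ℝ × ℝ) : 0 ≤ norm2 v := Real.sqrt_nonneg _

theorem norm2_sq (v : ℝ × ℝ) : norm2 v ^ 2 = v.1 ^ 2 + v.2 ^ 2 :=
  Real.sq_sqrt (by positivity)

theorem dot2_le_norm2_mul_norm2 (v w : ℝ × ℝ) : dot2 v w ≤ norm2 v * norm2 w := by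
  refine (abs_le_of_sq_le_sq' ?_ (mul_nonneg (norm2_nonneg v) (norm2_nonneg w))).2
  rw [mul_pow, norm2_sq, norm2_sq, dot2]
  nlinarith [sq_nonneg (v.1 * w.2 - v.2 * w.1)]

theorem norm2_smul {c : ℝ} (hc : 0 ≤ c) (v : ℝ × ℝ) :
    norm2 (c • v) = c * norm2 v := by
  rw [← sq_eq_sq₀ (norm2_nonneg _) (mul_nonneg hc (norm2_nonneg v)), mul_pow, norm2_sq,
    norm2_sq]
  simp only [Prod.smul_fst, Prod.smul_snd, smul_eq_mul]
  ring

/-- The support function of the closed ball of radius `K` is `v ↦ K * ‖v‖`. -/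
theorem isGreatest_dot2_ball {K : ℝ} (hK : 0 ≤ K) (v : ℝ × ℝ) :
    IsGreatest (range fun z : {z : ℝ × ℝ // norm2 z ≤ K} => dot2 z.1 v) (K * norm2 v) := by
  have hn := norm2_nonneg v
  constructor
  · have hz : norm2 ((K / norm2 v) • v) ≤ K := by
      rw [norm2_smul (div_nonneg hK hn)]
      rcases eq_or_ne (norm2 v) 0 with h0 | h0
      · simpa [h0] using hK
      · rw [div_mul_cancel₀ K h0]
    refine ⟨⟨(K / norm2 v) • v, hz⟩, ?_⟩
    have h : dot2 ((K / norm2 v) • v) v = K / norm2 v * norm2 v ^ 2 := by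
      rw [norm2_sq, dot2, Prod.smul_fst, Prod.smul_snd, smul_eq_mul, smul_eq_mul]
      ring
    change dot2 ((K / norm2 v) • v) v = _
    rw [h]
    rcases eq_or_ne (norm2 v) 0 with h0 | h0
    · simp [h0]
    · field_simp
  · rintro _ ⟨z, rfl⟩
    exact (dot2_le_norm2_mul_norm2 _ _).trans (mul_le_mul_of_nonneg_right z.2 hn)

theorem iSup_add_dot2_ball {K : ℝ} (hK : 0 ≤ K) (a : ℝ) (v : ℝ × ℝ) :
    ⨆ z : {z : ℝ × ℝ // norm2 z ≤ K}, (a + dot2 z.1 v) = a + K * norm2 v := by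
  obtain ⟨⟨z, hz⟩, hub⟩ := isGreatest_dot2_ball hK v
  refine IsGreatest.csSup_eq ⟨⟨z, by simpa using hz⟩, ?_⟩
  rintro _ ⟨w, rfl⟩
  simpa using hub ⟨w, rfl⟩

theorem iInf_sub_dot2_ball {K : ℝ} (hK : 0 ≤ K) (a : ℝ) (v : ℝ × ℝ) :
    ⨅ z : {z : ℝ × ℝ // norm2 z ≤ K}, (a - dot2 z.1 v) = a - K * norm2 v := by
  obtain ⟨⟨z, hz⟩, hub⟩ := isGreatest_dot2_ball hK v
  refine IsLeast.csInf_eq ⟨⟨z, by simpa using hz⟩, ?_⟩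
  rintro _ ⟨w, rfl⟩
  exact sub_le_sub_left (hub ⟨w, rfl⟩) a

/-- if `𝓗` is `K`-Lipschitz in `y`, with `Z` the ball of radius `K`,
`F(t,x,y,z) = -𝓗(T-t,x,y) + z·y` and `H⁻` the associated lower Hamiltonian, then for
`λ ∈ Y`:
`𝓗(t,x,λ) = min_{y∈Y} max_{z∈Z} (𝓗(t,x,y) + z·(λ-y)) = min_{y∈Y} (𝓗(t,x,y) + K‖λ-y‖)`
and `H⁻(T-t,x,λ) = -𝓗(t,x,λ)`. -/
theorem stmt_15 (T K RY : ℝ) (hT : 0 < T) (hK : 0 < K) (hRY : 0 < RY)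
    (H : ℝ → (ℝ × ℝ × ℝ) → (ℝ × ℝ) → ℝ)
    (hLip : ∀ t ∈ Set.Icc 0 T, ∀ (x : ℝ × ℝ × ℝ) (y y' : ℝ × ℝ),
      |H t x y - H t x y'| ≤ K * norm2 (y - y')) :
    ∀ t ∈ Set.Icc 0 T, ∀ (x : ℝ × ℝ × ℝ) (lam : ℝ × ℝ), norm2 lam ≤ RY →
      (H t x lam =
        ⨅ y : {y : ℝ × ℝ // norm2 y ≤ RY}, ⨆ z : {z : ℝ × ℝ // norm2 z ≤ K},
          (H t x y.1 + dot2 z.1 (lam - y.1))) ∧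
      (H t x lam =
        ⨅ y : {y : ℝ × ℝ // norm2 y ≤ RY}, (H t x y.1 + K * norm2 (lam - y.1))) ∧
      lowerHam RY K (fun s x' y z => -H (T - s) x' y + dot2 z y) (T - t) x lam =
        -H t x lam := by
  intro t ht x lam hlam
  have hle (y : ℝ × ℝ) : H t x lam ≤ H t x y + K * norm2 (lam - y) := by
    linarith [(abs_le.mp (hLip t ht x lam y)).2]
  have h0 : norm2 (lam - lam) = 0 := by simp [norm2]
  have hmin : H t x lam =
      ⨅ y : {y : ℝ × ℝ // norm2 y ≤ RY}, (H t x y.1 + K * norm2 (lam - y.1)) := by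
    symm
    refine IsLeast.csInf_eq ⟨⟨⟨lam, hlam⟩, by simp only [h0, mul_zero, add_zero]⟩, ?_⟩
    rintro _ ⟨y, rfl⟩
    exact hle y.1
  refine ⟨?_, hmin, ?_⟩
  · simpa only [iSup_add_dot2_ball hK.le] using hmin
  · have hF (y z : ℝ × ℝ) : -H (T - (T - t)) x y + dot2 z y - dot2 lam z =
        -H t x y - dot2 z (lam - y) := by
      rw [sub_sub_cancel]
      simp only [dot2, Prod.fst_sub, Prod.snd_sub]
      ring
    simp only [lowerHam, hF, iInf_sub_dot2_ball hK.le]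
    refine IsGreatest.csSup_eq ⟨⟨⟨lam, hlam⟩, by simp only [h0, mul_zero, sub_zero]⟩, ?_⟩
    rintro _ ⟨y, rfl⟩
    linarith [hle y.1]
end
end
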